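/- If for some n ≥ 1 the n-fold tensor power ρ_AB^{⊗n} can be locally transformed to σ_EF, i.e., σ_EF = (Φ ⊗ Ψ)(ρ_AB^{⊗n}) for some completely positive trace-preserving maps Φ acting on the n A-systems and Ψ acting on the n B-systems, then μ_ent(ρ_AB) ≥ μ_ent(σ_EF). -/

import Mathlib

open scoped Matrix Kronecker ComplexOrder
open Matrix

noncomputable section

/-- Partial trace over the second (B) system. -/
def ptrB {A B : Type*} [Fintype B] (ρ : Matrix (A × B) (A × B) ℂ) : Matrix A A ℂ :=
  fun i j => ∑ k, ρ (i, k) (j, k)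

/-- Partial trace over the first (A) system. -/
def ptrA {A B : Type*} [Fintype A] (ρ : Matrix (A × B) (A × B) ℂ) : Matrix B B ℂ :=
  fun k l => ∑ i, ρ (i, k) (i, l)

/-- A density matrix: positive semidefinite with trace one. -/
def IsDensity {n : Type*} [Fintype n] (ρ : Matrix n n ℂ) : Prop :=
  ρ.PosSemidef ∧ ρ.trace = 1

/-- Maximal correlation of a bipartite state. -/
def mu {A B : Type*} [Fintype A] [Fintype B] (ρ : Matrix (A × B) (A × B) ℂ) : ℝ :=
  sSup {r : ℝ | ∃ (X : Matrix A A ℂ) (Y : Matrix B B ℂ),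
    ((ptrB ρ) * X).trace = 0 ∧ ((ptrA ρ) * Y).trace = 0 ∧
    ((ptrB ρ) * (X * Xᴴ)).trace = 1 ∧ ((ptrA ρ) * (Y * Yᴴ)).trace = 1 ∧
    r = ‖((ρ * (X ⊗ₖ Yᴴ)).trace)‖}

/-- Maximal entanglement: infimum over finite decompositions of the max correlation. -/
def muEnt {A B : Type*} [Fintype A] [Fintype B] (ρ : Matrix (A × B) (A × B) ℂ) : ℝ :=
  sInf {r : ℝ | ∃ (m : ℕ) (p : Fin m → ℝ) (τ : Fin m → Matrix (A × B) (A × B) ℂ),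
    (∀ i, 0 ≤ p i) ∧ (∑ i, p i) = 1 ∧ (∀ i, IsDensity (τ i)) ∧
    ρ = ∑ i, p i • τ i ∧ r = ⨆ i, mu (τ i)}

/-- Application of a product channel given by local Kraus operators. -/
def applyLocal {A B A' B' ι κ : Type*} [Fintype A] [Fintype B] [Fintype ι] [Fintype κ]
    (K : ι → Matrix A' A ℂ) (L : κ → Matrix B' B ℂ)
    (ρ : Matrix (A × B) (A × B) ℂ) : Matrix (A' × B') (A' × B') ℂ :=
  ∑ k, ∑ m, (K k ⊗ₖ L m) * ρ * (K k ⊗ₖ L m)ᴴ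

/-- Tensor product of two bipartite states, with the A-systems grouped together. -/
def prodState {A B A' B' : Type*}
    (ρ : Matrix (A × B) (A × B) ℂ) (σ : Matrix (A' × B') (A' × B') ℂ) :
    Matrix ((A × A') × (B × B')) ((A × A') × (B × B')) ℂ :=
  fun x y => ρ (x.1.1, x.2.1) (y.1.1, y.2.1) * σ (x.1.2, x.2.2) (y.1.2, y.2.2)

/-- n-fold tensor power of a bipartite state, with all A-systems grouped together. -/
def powState {A B : Type*} (ρ : Matrix (A × B) (A × B) ℂ) (n : ℕ) :
    Matrix ((Fin n → A) × (Fin n → B)) ((Fin n → A) × (Fin n → B)) ℂ :=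
  fun x y => ∏ i, ρ (x.1 i, x.2 i) (y.1 i, y.2 i)

/-- The two-qubit Bell vector (|00⟩+|11⟩)/√2. -/
def bellVec : Fin 2 × Fin 2 → ℂ := fun p => if p.1 = p.2 then 1 / (Real.sqrt 2 : ℂ) else 0

/-- Inverse of the positive semidefinite square root. -/
def invSqrt {n : Type*} [Fintype n] [DecidableEq n] (M : Matrix n n ℂ) : Matrix n n ℂ :=
  letI := Classical.dec M.PosSemidef
  if h : M.PosSemidef then
    ((h.1.eigenvectorUnitary : Matrix n n ℂ) *
      diagonal ((↑) ∘ Real.sqrt ∘ h.1.eigenvalues : n → ℂ) *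
      (star h.1.eigenvectorUnitary : Matrix n n ℂ))⁻¹
  else 0

/-- The expectation of the product observable `M ⊗ N` in the bipartite state `ρ`. -/
def expect {A B : Type*} [Fintype A] [Fintype B] (ρ : Matrix (A × B) (A × B) ℂ)
    (M : Matrix A A ℂ) (N : Matrix B B ℂ) : ℂ :=
  (ρ * (M ⊗ₖ N)).trace

section Expect

variable {A B : Type*} [Fintype A] [Fintype B] (ρ : Matrix (A × B) (A × B) ℂ)

lemma expect_add_left (M M' : Matrix A A ℂ) (N : Matrix B B ℂ) :
    expect ρ (M + M') N = expect ρ M N + expect ρ M' N := by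
  simp [expect, add_kronecker, mul_add]

lemma expect_add_right (M : Matrix A A ℂ) (N N' : Matrix B B ℂ) :
    expect ρ M (N + N') = expect ρ M N + expect ρ M N' := by
  simp [expect, kronecker_add, mul_add]

lemma expect_smul_left (c : ℂ) (M : Matrix A A ℂ) (N : Matrix B B ℂ) :
    expect ρ (c • M) N = c * expect ρ M N := by
  simp [expect, smul_kronecker]

lemma expect_smul_right (c : ℂ) (M : Matrix A A ℂ) (N : Matrix B B ℂ) :
    expect ρ M (c • N) = c * expect ρ M N := by
  simp [expect, kronecker_smul]

lemma expect_sub_left (M M' : Matrix A A ℂ) (N : Matrix B B ℂ) :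
    expect ρ (M - M') N = expect ρ M N - expect ρ M' N := by
  rw [eq_sub_iff_add_eq, ← expect_add_left, sub_add_cancel]

lemma expect_sub_right (M : Matrix A A ℂ) (N N' : Matrix B B ℂ) :
    expect ρ M (N - N') = expect ρ M N - expect ρ M N' := by
  rw [eq_sub_iff_add_eq, ← expect_add_right, sub_add_cancel]

lemma expect_sum_left {ι : Type*} (s : Finset ι) (M : ι → Matrix A A ℂ) (N : Matrix B B ℂ) :
    expect ρ (∑ i ∈ s, M i) N = ∑ i ∈ s, expect ρ (M i) N := by
  classical
  induction s using Finset.induction_on with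
  | empty => simp [expect]
  | insert i s hi ih => rw [Finset.sum_insert hi, Finset.sum_insert hi, expect_add_left, ih]

lemma expect_sum_right {ι : Type*} (s : Finset ι) (M : Matrix A A ℂ) (N : ι → Matrix B B ℂ) :
    expect ρ M (∑ i ∈ s, N i) = ∑ i ∈ s, expect ρ M (N i) := by
  classical
  induction s using Finset.induction_on with
  | empty => simp [expect]
  | insert i s hi ih => rw [Finset.sum_insert hi, Finset.sum_insert hi, expect_add_right, ih]

variable {ρ}

lemma expect_conjTranspose (hρ : ρ.IsHermitian) (M : Matrix A A ℂ) (N : Matrix B B ℂ) :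
    expect ρ Mᴴ Nᴴ = star (expect ρ M N) := by
  rw [expect, expect, ← trace_conjTranspose, conjTranspose_mul, conjTranspose_kronecker, hρ.eq,
    trace_mul_comm]

lemma trace_mul_mul_conjTranspose_nonneg {m n : Type*} [Fintype m] [Fintype n]
    {P : Matrix n n ℂ} (hP : P.PosSemidef) (C : Matrix n m ℂ) : 0 ≤ (P * (C * Cᴴ)).trace := by
  have h := (hP.conjTranspose_mul_mul_same C).trace_nonneg
  rwa [Matrix.mul_assoc, trace_mul_comm, Matrix.mul_assoc] at h

variable [DecidableEq A] [DecidableEq B]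

omit [DecidableEq A] in
lemma trace_ptrB_mul (M : Matrix A A ℂ) : (ptrB ρ * M).trace = expect ρ M 1 := by
  simp only [expect, trace, diag, mul_apply, ptrB, Fintype.sum_prod_type, kroneckerMap_apply,
    one_apply, mul_ite, mul_one, mul_zero, Finset.sum_ite_eq', Finset.mem_univ, if_true,
    Finset.sum_mul]
  exact Finset.sum_congr rfl fun _ _ => Finset.sum_comm

omit [DecidableEq B] in
lemma trace_ptrA_mul (N : Matrix B B ℂ) : (ptrA ρ * N).trace = expect ρ 1 N := by
  have h (a : A) (b : B) : ∑ a', ∑ b', ρ (a, b) (a', b') * ((1 : Matrix A A ℂ) a' a * N b' b)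
      = ∑ b', ρ (a, b) (a, b') * N b' b := by
    rw [Finset.sum_eq_single a]
    · simp
    · intro a' _ ha
      simp [ha]
    · simp
  simp only [expect, trace, diag, mul_apply, ptrA, Fintype.sum_prod_type, kroneckerMap_apply,
    h, Finset.sum_mul]
  conv_rhs => rw [Finset.sum_comm]
  exact Finset.sum_congr rfl fun _ _ => Finset.sum_comm

lemma expect_one_one : expect ρ 1 1 = ρ.trace := by
  simp [expect]

lemma expect_local_sum_nonneg (hρ : ρ.PosSemidef) (X : Matrix A A ℂ) (Y : Matrix B B ℂ) :
    0 ≤ expect ρ (X * Xᴴ) 1 + expect ρ 1 (Y * Yᴴ) +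
      (expect ρ X Yᴴ + star (expect ρ X Yᴴ)) := by
  convert trace_mul_mul_conjTranspose_nonneg hρ (X ⊗ₖ (1 : Matrix B B ℂ) + 1 ⊗ₖ Y) using 1
  rw [← expect_conjTranspose hρ.1]
  simp only [conjTranspose_add, conjTranspose_kronecker, conjTranspose_one, mul_add, add_mul,
    ← mul_kronecker_mul, one_mul, mul_one, trace_add, expect, conjTranspose_conjTranspose]
  ring

omit [DecidableEq A] in
lemma expect_mul_conjTranspose_left_nonneg {m : Type*} [Fintype m] (hρ : ρ.PosSemidef)
    (X : Matrix A m ℂ) : 0 ≤ expect ρ (X * Xᴴ) 1 := by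
  simpa [expect, conjTranspose_kronecker, ← mul_kronecker_mul] using
    trace_mul_mul_conjTranspose_nonneg hρ (X ⊗ₖ (1 : Matrix B B ℂ))

omit [DecidableEq B] in
lemma expect_mul_conjTranspose_right_nonneg {m : Type*} [Fintype m] (hρ : ρ.PosSemidef)
    (Y : Matrix B m ℂ) : 0 ≤ expect ρ 1 (Y * Yᴴ) := by
  simpa [expect, conjTranspose_kronecker, ← mul_kronecker_mul] using
    trace_mul_mul_conjTranspose_nonneg hρ ((1 : Matrix A A ℂ) ⊗ₖ Y)

lemma exists_norm_one_mul_eq_neg_norm (z : ℂ) : ∃ u : ℂ, ‖u‖ = 1 ∧ u * z = -‖z‖ := by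
  obtain ⟨c, hc, h⟩ := RCLike.exists_norm_eq_mul_self z
  exact ⟨-c, by simpa using hc, by rw [neg_mul, ← h]; rfl⟩

lemma expect_smul_mul_conjTranspose_left (c : ℂ) (X : Matrix A A ℂ) :
    (expect ρ ((c • X) * (c • X)ᴴ) 1) = (‖c‖ ^ 2 : ℝ) * (expect ρ (X * Xᴴ) 1) := by
  rw [conjTranspose_smul, smul_mul_smul_comm, expect_smul_left, RCLike.star_def, Complex.mul_conj']
  push_cast
  rfl

lemma expect_smul_mul_conjTranspose_right (c : ℂ) (Y : Matrix B B ℂ) :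
    (expect ρ 1 ((c • Y) * (c • Y)ᴴ)) = (‖c‖ ^ 2 : ℝ) * (expect ρ 1 (Y * Yᴴ)) := by
  rw [conjTranspose_smul, smul_mul_smul_comm, expect_smul_right, RCLike.star_def,
    Complex.mul_conj']
  push_cast
  rfl

lemma norm_expect_sq_le (hρ : ρ.PosSemidef) (X : Matrix A A ℂ) (Y : Matrix B B ℂ) :
    ‖expect ρ X Yᴴ‖ ^ 2 ≤ (expect ρ (X * Xᴴ) 1).re * (expect ρ 1 (Y * Yᴴ)).re := by
  obtain ⟨u, hu, hut⟩ := exists_norm_one_mul_eq_neg_norm (expect ρ X Yᴴ)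
  have ha := (Complex.le_def.1 (expect_mul_conjTranspose_left_nonneg hρ X)).1
  have hb := (Complex.le_def.1 (expect_mul_conjTranspose_right_nonneg hρ Y)).1
  have key (r s : ℝ) : 0 ≤ r ^ 2 * (expect ρ (X * Xᴴ) 1).re + s ^ 2 * (expect ρ 1 (Y * Yᴴ)).re
      - 2 * (r * s * ‖expect ρ X Yᴴ‖) := by
    have h := (Complex.le_def.1
      (expect_local_sum_nonneg hρ (((r : ℂ) * u) • X) ((s : ℂ) • Y))).1
    have ht : expect ρ (((r : ℂ) * u) • X) ((s : ℂ) • Y)ᴴ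
        = ((-(r * s * ‖expect ρ X Yᴴ‖) : ℝ) : ℂ) := by
      rw [conjTranspose_smul, expect_smul_left, expect_smul_right]
      simp only [RCLike.star_def, Complex.conj_ofReal]
      push_cast
      linear_combination (r : ℂ) * s * hut
    rw [expect_smul_mul_conjTranspose_left, expect_smul_mul_conjTranspose_right, ht] at h
    simp only [Complex.add_re, Complex.re_ofReal_mul, norm_mul, hu, Complex.norm_real, mul_one,
      Real.norm_eq_abs, sq_abs, Complex.ofReal_re, RCLike.star_def, Complex.conj_ofReal,
      Complex.zero_re] at h
    linarith
  simp only [Complex.zero_re] at ha hb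
  generalize ‖expect ρ X Yᴴ‖ = t at *
  generalize (expect ρ (X * Xᴴ) 1).re = a at *
  generalize (expect ρ 1 (Y * Yᴴ)).re = b at *
  rcases hb.eq_or_lt with rfl | hb
  · nlinarith [key t (a + 1)]
  · have h := key b t
    have : 0 ≤ b * (a * b - t ^ 2) := by linarith
    linarith [nonneg_of_mul_nonneg_right this hb]

end Expect

/-- The maximal correlation bound `|⟨X ⊗ Y†⟩| ≤ c ‖X‖ ‖Y‖` on centred observables, in the
equivalent additive form. -/
def IsCorrBound {A B : Type*} [Fintype A] [Fintype B] [DecidableEq A] [DecidableEq B]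
    (ρ : Matrix (A × B) (A × B) ℂ) (c : ℝ) : Prop :=
  ∀ (X : Matrix A A ℂ) (Y : Matrix B B ℂ), expect ρ X 1 = 0 → expect ρ 1 Y = 0 →
    0 ≤ c * ((expect ρ (X * Xᴴ) 1).re + (expect ρ 1 (Y * Yᴴ)).re) + 2 * (expect ρ X Yᴴ).re

section Mu

variable {A B : Type*} [Fintype A] [Fintype B] {ρ : Matrix (A × B) (A × B) ℂ} {c : ℝ}

lemma mu_nonneg : 0 ≤ mu ρ := by
  apply Real.sSup_nonneg
  rintro r ⟨X, Y, -, -, -, -, rfl⟩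
  exact norm_nonneg _

variable [DecidableEq A] [DecidableEq B]

lemma IsCorrBound.mu_le (hc : 0 ≤ c) (h : IsCorrBound ρ c) : mu ρ ≤ c := by
  refine Real.sSup_le ?_ hc
  rintro r ⟨X, Y, hX, hY, hX1, hY1, rfl⟩
  rw [trace_ptrB_mul] at hX hX1
  rw [trace_ptrA_mul] at hY hY1
  change ‖expect ρ X Yᴴ‖ ≤ c
  obtain ⟨u, hu, hut⟩ := exists_norm_one_mul_eq_neg_norm (expect ρ X Yᴴ)
  have := h (u • X) Y (by rw [expect_smul_left, hX, mul_zero]) hY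
  rw [expect_smul_mul_conjTranspose_left, hX1, hY1, expect_smul_left, hut, hu] at this
  norm_num at this
  linarith

lemma norm_expect_le_mu (hρ : ρ.PosSemidef) {X : Matrix A A ℂ} {Y : Matrix B B ℂ}
    (hX : expect ρ X 1 = 0) (hY : expect ρ 1 Y = 0) (hX1 : expect ρ (X * Xᴴ) 1 = 1)
    (hY1 : expect ρ 1 (Y * Yᴴ) = 1) : ‖expect ρ X Yᴴ‖ ≤ mu ρ := by
  apply le_csSup
  · refine ⟨1, ?_⟩
    rintro r ⟨X, Y, hX, hY, hX1, hY1, rfl⟩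
    rw [trace_ptrB_mul] at hX1
    rw [trace_ptrA_mul] at hY1
    have := norm_expect_sq_le hρ X Y
    rw [hX1, hY1] at this
    change ‖expect ρ X Yᴴ‖ ≤ 1
    norm_num at this
    exact this
  · refine ⟨X, Y, ?_⟩
    rw [trace_ptrB_mul, trace_ptrB_mul, trace_ptrA_mul, trace_ptrA_mul]
    exact ⟨hX, hY, hX1, hY1, rfl⟩

lemma isCorrBound_of_mu_le (hρ : ρ.PosSemidef) (h : mu ρ ≤ c) : IsCorrBound ρ c := by
  intro X Y hX hY
  have hcs := norm_expect_sq_le hρ X Y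
  obtain ⟨ha, ha'⟩ := Complex.le_def.1 (expect_mul_conjTranspose_left_nonneg hρ X)
  obtain ⟨hb, hb'⟩ := Complex.le_def.1 (expect_mul_conjTranspose_right_nonneg hρ Y)
  simp only [Complex.zero_re, Complex.zero_im] at ha hb ha' hb'
  have hc : 0 ≤ c := mu_nonneg.trans h
  have hre := Complex.abs_re_le_norm (expect ρ X Yᴴ)
  have hae : expect ρ (X * Xᴴ) 1 = ((expect ρ (X * Xᴴ) 1).re : ℂ) := Complex.ext rfl ha'.symm
  have hbe : expect ρ 1 (Y * Yᴴ) = ((expect ρ 1 (Y * Yᴴ)).re : ℂ) := Complex.ext rfl hb'.symm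
  set a := (expect ρ (X * Xᴴ) 1).re
  set b := (expect ρ 1 (Y * Yᴴ)).re
  suffices ‖expect ρ X Yᴴ‖ ≤ c * (√a * √b) by
    nlinarith [abs_le.1 hre, mul_nonneg hc (sq_nonneg (√a - √b)), Real.sq_sqrt ha,
      Real.sq_sqrt hb]
  by_cases hab : a * b = 0
  · rw [hab] at hcs
    have : ‖expect ρ X Yᴴ‖ = 0 := by nlinarith [norm_nonneg (expect ρ X Yᴴ)]
    rw [this]
    positivity
  have ha0 : 0 < √a := Real.sqrt_pos.2 (ha.lt_of_ne' (left_ne_zero_of_mul hab))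
  have hb0 : 0 < √b := Real.sqrt_pos.2 (hb.lt_of_ne' (right_ne_zero_of_mul hab))
  have key := norm_expect_le_mu hρ (X := ((√a)⁻¹ : ℂ) • X) (Y := ((√b)⁻¹ : ℂ) • Y)
    (by rw [expect_smul_left, hX, mul_zero]) (by rw [expect_smul_right, hY, mul_zero])
    (by
      rw [expect_smul_mul_conjTranspose_left, hae, norm_inv, Complex.norm_real, Real.norm_eq_abs,
        inv_pow, sq_abs, Real.sq_sqrt ha, ← Complex.ofReal_mul,
        inv_mul_cancel₀ (left_ne_zero_of_mul hab), Complex.ofReal_one])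
    (by
      rw [expect_smul_mul_conjTranspose_right, hbe, norm_inv, Complex.norm_real, Real.norm_eq_abs,
        inv_pow, sq_abs, Real.sq_sqrt hb, ← Complex.ofReal_mul,
        inv_mul_cancel₀ (right_ne_zero_of_mul hab), Complex.ofReal_one])
  rw [conjTranspose_smul, expect_smul_left, expect_smul_right, norm_mul, norm_mul, norm_star,
    norm_inv, norm_inv, Complex.norm_real, Complex.norm_real, Real.norm_of_nonneg ha0.le,
    Real.norm_of_nonneg hb0.le] at key
  have := key.trans h
  rwa [← mul_assoc, ← mul_inv, inv_mul_le_iff₀ (mul_pos ha0 hb0), mul_comm] at this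

end Mu

section Channel

variable {A B A' B' ι κ : Type*} [Fintype A] [Fintype B] [Fintype A'] [Fintype B']
  [Fintype ι] [Fintype κ]

/-- The Heisenberg picture (dual map) of the channel with Kraus operators `K`. -/
def krausDual (K : ι → Matrix A' A ℂ) (X : Matrix A' A' ℂ) : Matrix A A ℂ :=
  ∑ k, (K k)ᴴ * X * K k

omit [Fintype A] in
lemma krausDual_conjTranspose (K : ι → Matrix A' A ℂ) (X : Matrix A' A' ℂ) :
    krausDual K Xᴴ = (krausDual K X)ᴴ := by
  simp [krausDual, conjTranspose_sum, conjTranspose_mul, Matrix.mul_assoc]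

lemma expect_applyLocal (K : ι → Matrix A' A ℂ) (L : κ → Matrix B' B ℂ)
    (ρ : Matrix (A × B) (A × B) ℂ) (M : Matrix A' A' ℂ) (N : Matrix B' B' ℂ) :
    expect (applyLocal K L ρ) M N = expect ρ (krausDual K M) (krausDual L N) := by
  rw [krausDual, expect_sum_left]
  simp_rw [krausDual, expect_sum_right]
  simp only [expect, applyLocal, Matrix.sum_mul, trace_sum, mul_kronecker_mul,
    conjTranspose_kronecker]
  refine Finset.sum_congr rfl fun k _ => Finset.sum_congr rfl fun m _ => ?_
  rw [← conjTranspose_kronecker, Matrix.mul_assoc, Matrix.mul_assoc, trace_mul_comm]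
  simp only [Matrix.mul_assoc]

variable [DecidableEq A] [DecidableEq B] [DecidableEq A'] [DecidableEq B']

omit [Fintype A] in
lemma krausDual_one {K : ι → Matrix A' A ℂ} (hK : ∑ k, (K k)ᴴ * K k = 1) :
    krausDual K 1 = 1 := by
  simpa [krausDual] using hK

omit [DecidableEq A'] in
lemma krausDual_mul_conjTranspose {K : ι → Matrix A' A ℂ} (hK : ∑ k, (K k)ᴴ * K k = 1)
    (X : Matrix A' A' ℂ) :
    krausDual K (X * Xᴴ) = krausDual K X * (krausDual K X)ᴴ +
      ∑ k, ((K k)ᴴ * X - krausDual K X * (K k)ᴴ) * ((K k)ᴴ * X - krausDual K X * (K k)ᴴ)ᴴ := by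
  have h1 : ∑ k, (K k)ᴴ * X * ((K k) * (krausDual K X)ᴴ)
      = krausDual K X * (krausDual K X)ᴴ := by
    simp_rw [← Matrix.mul_assoc, ← Matrix.sum_mul]
    rfl
  have h2 : ∑ k, krausDual K X * (K k)ᴴ * (Xᴴ * K k)
      = krausDual K X * (krausDual K X)ᴴ := by
    rw [← krausDual_conjTranspose]
    simp_rw [Matrix.mul_assoc, ← Matrix.mul_sum, ← Matrix.mul_assoc]
    rfl
  have h3 : ∑ k, krausDual K X * (K k)ᴴ * (K k * (krausDual K X)ᴴ)
      = krausDual K X * (krausDual K X)ᴴ := by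
    have (k : ι) : krausDual K X * (K k)ᴴ * (K k * (krausDual K X)ᴴ)
        = krausDual K X * ((K k)ᴴ * K k * (krausDual K X)ᴴ) := by
      simp only [Matrix.mul_assoc]
    simp_rw [this]
    rw [← Matrix.mul_sum, ← Matrix.sum_mul, hK, Matrix.one_mul]
  have h4 : ∑ k, (K k)ᴴ * X * (Xᴴ * K k) = krausDual K (X * Xᴴ) := by
    simp [krausDual, Matrix.mul_assoc]
  simp only [conjTranspose_sub, conjTranspose_mul, conjTranspose_conjTranspose, Matrix.sub_mul,
    Matrix.mul_sub, Finset.sum_sub_distrib, h1, h2, h3, h4]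
  abel

omit [DecidableEq A'] in
lemma expect_mul_conjTranspose_krausDual_left_le {ρ : Matrix (A × B) (A × B) ℂ}
    (hρ : ρ.PosSemidef) {K : ι → Matrix A' A ℂ} (hK : ∑ k, (K k)ᴴ * K k = 1)
    (X : Matrix A' A' ℂ) :
    expect ρ (krausDual K X * (krausDual K X)ᴴ) 1 ≤ expect ρ (krausDual K (X * Xᴴ)) 1 := by
  rw [krausDual_mul_conjTranspose hK, expect_add_left, expect_sum_left]
  refine le_add_of_nonneg_right (Finset.sum_nonneg fun k _ => ?_)
  exact expect_mul_conjTranspose_left_nonneg hρ _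

omit [DecidableEq B'] in
lemma expect_mul_conjTranspose_krausDual_right_le {ρ : Matrix (A × B) (A × B) ℂ}
    (hρ : ρ.PosSemidef) {L : κ → Matrix B' B ℂ} (hL : ∑ m, (L m)ᴴ * L m = 1)
    (Y : Matrix B' B' ℂ) :
    expect ρ 1 (krausDual L Y * (krausDual L Y)ᴴ) ≤ expect ρ 1 (krausDual L (Y * Yᴴ)) := by
  rw [krausDual_mul_conjTranspose hL, expect_add_right, expect_sum_right]
  refine le_add_of_nonneg_right (Finset.sum_nonneg fun k _ => ?_)
  exact expect_mul_conjTranspose_right_nonneg hρ _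

lemma IsCorrBound.applyLocal {ρ : Matrix (A × B) (A × B) ℂ} {c : ℝ} (hρ : ρ.PosSemidef)
    (hc : 0 ≤ c) (h : IsCorrBound ρ c) {K : ι → Matrix A' A ℂ} {L : κ → Matrix B' B ℂ}
    (hK : ∑ k, (K k)ᴴ * K k = 1) (hL : ∑ m, (L m)ᴴ * L m = 1) :
    IsCorrBound (applyLocal K L ρ) c := by
  intro X Y hX hY
  simp only [expect_applyLocal, krausDual_one hK, krausDual_one hL,
    krausDual_conjTranspose] at hX hY ⊢
  refine (h _ _ hX hY).trans ?_
  gcongr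
  · exact expect_mul_conjTranspose_krausDual_left_le hρ hK X
  · exact expect_mul_conjTranspose_krausDual_right_le hρ hL Y

end Channel

section HadamardProduct

variable {ι J : Type*} {N W : ι → Matrix J J ℂ}

lemma posSemidef_entrywise_prod [Finite J] (hN : ∀ i, (N i).PosSemidef) (s : Finset ι) :
    (of fun j k => ∏ i ∈ s, N i j k).PosSemidef := by
  classical
  induction s using Finset.induction_on with
  | empty =>
    have := Fintype.ofFinite J
    convert posSemidef_vecMulVec_star_self (fun _ : J => (1 : ℂ)) using 1
    ext
    simp [vecMulVec_apply]
  | insert a s ha ih =>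
    have h : (of fun j k => ∏ i ∈ insert a s, N i j k)
        = N a ⊙ of fun j k => ∏ i ∈ s, N i j k := by
      ext
      simp [Finset.prod_insert ha]
    rw [h]
    exact (hN a).hadamard ih

/-- If `E ⊙ (N i - W i)` is positive semidefinite for each `i`, then so is
`E ⊙ (∏ N i - ∏ W i)`, all products being entrywise. -/
lemma posSemidef_hadamard_entrywise_prod_sub [Finite J] {E : Matrix J J ℂ}
    (hN : ∀ i, (N i).PosSemidef) (hW : ∀ i, (W i).PosSemidef)
    (h : ∀ i, (E ⊙ (N i - W i)).PosSemidef) (s : Finset ι) :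
    (E ⊙ ((of fun j k => ∏ i ∈ s, N i j k) - of fun j k => ∏ i ∈ s, W i j k)).PosSemidef := by
  classical
  induction s using Finset.induction_on with
  | empty =>
    convert PosSemidef.zero using 1
    ext
    simp
  | insert a s ha ih =>
    have key : E ⊙ ((of fun j k => ∏ i ∈ insert a s, N i j k)
          - of fun j k => ∏ i ∈ insert a s, W i j k)
        = (E ⊙ (N a - W a)) ⊙ (of fun j k => ∏ i ∈ s, N i j k)
          + W a ⊙ (E ⊙ ((of fun j k => ∏ i ∈ s, N i j k) - of fun j k => ∏ i ∈ s, W i j k)) := by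
      ext
      simp only [hadamard_apply, Matrix.sub_apply, of_apply, Matrix.add_apply,
        Finset.prod_insert ha]
      ring
    rw [key]
    exact ((h a).hadamard (posSemidef_entrywise_prod hN s)).add ((hW a).hadamard ih)

end HadamardProduct

section CorrGram

variable {A B : Type*} [Fintype A] [Fintype B] [DecidableEq A] [DecidableEq B]

/-- The Gram matrix of the local matrix units of both systems with respect to the form
`⟨Z, Z'⟩ = tr (ρ Z Z'†)`. -/
def corrGram (ρ : Matrix (A × B) (A × B) ℂ) :
    Matrix ((A × A) ⊕ (B × B)) ((A × A) ⊕ (B × B)) ℂ :=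
  fromBlocks
    (of fun p q => if q.2 = p.2 then ptrB ρ p.1 q.1 else 0)
    (of fun p q => ρ (p.1, q.2) (p.2, q.1))
    (of fun p q => ρ (q.2, p.1) (q.1, p.2))
    (of fun p q => if q.2 = p.2 then ptrA ρ p.1 q.1 else 0)

/-- The expectations of the local matrix units of both systems. -/
def corrMean (ρ : Matrix (A × B) (A × B) ℂ) : (A × A) ⊕ (B × B) → ℂ :=
  Sum.elim (fun p => ptrB ρ p.2 p.1) (fun p => ptrA ρ p.2 p.1)

/-- The `2 × 2` block matrix with constant diagonal blocks `c` and off-diagonal blocks `1`. -/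
def blockWeight (P Q : Type*) (c : ℝ) : Matrix (P ⊕ Q) (P ⊕ Q) ℂ :=
  fromBlocks (of fun _ _ => (c : ℂ)) (of fun _ _ => 1) (of fun _ _ => 1) (of fun _ _ => (c : ℂ))

lemma blockWeight_isHermitian (P Q : Type*) (c : ℝ) : (blockWeight P Q c).IsHermitian := by
  ext (i | i) (j | j) <;> simp [blockWeight]

lemma blockWeight_one_hadamard {P Q : Type*} (M : Matrix (P ⊕ Q) (P ⊕ Q) ℂ) :
    blockWeight P Q 1 ⊙ M = M := by
  ext (i | i) (j | j) <;> simp [blockWeight]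

/-- The coordinates of the local observables `X` and `Y` in the matrix units. -/
def localVec (X : Matrix A A ℂ) (Y : Matrix B B ℂ) : (A × A) ⊕ (B × B) → ℂ :=
  Sum.elim (fun p => X p.1 p.2) (fun p => Y p.1 p.2)

lemma star_dotProduct_blockWeight_hadamard_mulVec {P Q : Type*} [Fintype P] [Fintype Q] (c : ℝ)
    (M : Matrix (P ⊕ Q) (P ⊕ Q) ℂ) (x : P ⊕ Q → ℂ) :
    star x ⬝ᵥ (blockWeight P Q c ⊙ M) *ᵥ x =
      c * ((∑ p, ∑ q, star (x (.inl p)) * M (.inl p) (.inl q) * x (.inl q)) +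
        ∑ p, ∑ q, star (x (.inr p)) * M (.inr p) (.inr q) * x (.inr q)) +
      ((∑ p, ∑ q, star (x (.inr p)) * M (.inr p) (.inl q) * x (.inl q)) +
        ∑ p, ∑ q, star (x (.inl p)) * M (.inl p) (.inr q) * x (.inr q)) := by
  simp only [dotProduct, mulVec, Fintype.sum_sum_type, blockWeight, hadamard_apply, Pi.star_apply,
    fromBlocks_apply₁₁, fromBlocks_apply₁₂, fromBlocks_apply₂₁, fromBlocks_apply₂₂, of_apply,
    one_mul, mul_add, Finset.mul_sum, Finset.sum_add_distrib]
  have h (a b d : ℂ) : a * (c * b * d) = c * (a * b * d) := by ring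
  simp only [h, ← mul_assoc]
  ring

variable {ρ : Matrix (A × B) (A × B) ℂ}

omit [Fintype A] [DecidableEq A] [DecidableEq B] in
lemma ptrB_star (hρ : ρ.IsHermitian) (i j : A) : star (ptrB ρ i j) = ptrB ρ j i := by
  simp [ptrB, star_sum, hρ.apply]

omit [Fintype B] [DecidableEq A] [DecidableEq B] in
lemma ptrA_star (hρ : ρ.IsHermitian) (i j : B) : star (ptrA ρ i j) = ptrA ρ j i := by
  simp [ptrA, star_sum, hρ.apply]

lemma corrGram_isHermitian (hρ : ρ.IsHermitian) : (corrGram ρ).IsHermitian := by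
  ext (i | i) (j | j)
  · by_cases h : i.2 = j.2 <;> simp [corrGram, h, Ne.symm, ptrB_star hρ]
  · simpa [corrGram] using hρ.apply _ _
  · simpa [corrGram] using hρ.apply _ _
  · by_cases h : i.2 = j.2 <;> simp [corrGram, h, Ne.symm, ptrA_star hρ]

omit [DecidableEq A] [DecidableEq B] in
lemma expect_eq_sum (M : Matrix A A ℂ) (N : Matrix B B ℂ) :
    expect ρ M N = ∑ a, ∑ b, ∑ a', ∑ b', ρ (a, b) (a', b') * (M a' a * N b' b) := by
  simp [expect, trace, mul_apply, Fintype.sum_prod_type]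

omit [DecidableEq A] in
lemma corrMean_sum_inl (X : Matrix A A ℂ) (Y : Matrix B B ℂ) :
    ∑ p, corrMean ρ (.inl p) * localVec X Y (.inl p) = expect ρ X 1 := by
  simp only [corrMean, localVec, Sum.elim_inl, ← trace_ptrB_mul, trace, diag, mul_apply,
    Fintype.sum_prod_type]
  exact Finset.sum_comm

omit [DecidableEq B] in
lemma corrMean_sum_inr (X : Matrix A A ℂ) (Y : Matrix B B ℂ) :
    ∑ p, corrMean ρ (.inr p) * localVec X Y (.inr p) = expect ρ 1 Y := by
  simp only [corrMean, localVec, Sum.elim_inr, ← trace_ptrA_mul, trace, diag, mul_apply,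
    Fintype.sum_prod_type]
  exact Finset.sum_comm

lemma corrGram_quadratic_form (hρ : ρ.IsHermitian) (c : ℝ) (X : Matrix A A ℂ)
    (Y : Matrix B B ℂ) :
    star (localVec X Y) ⬝ᵥ (blockWeight _ _ c ⊙ corrGram ρ) *ᵥ localVec X Y =
      c * (expect ρ (X * Xᴴ) 1 + expect ρ 1 (Y * Yᴴ)) +
        (expect ρ X Yᴴ + star (expect ρ X Yᴴ)) := by
  rw [star_dotProduct_blockWeight_hadamard_mulVec, ← expect_conjTranspose hρ]
  congr! 2
  · congr 1
    · simp only [corrGram, localVec, fromBlocks_apply₁₁, of_apply, Sum.elim_inl,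
        Fintype.sum_prod_type, ← trace_ptrB_mul, trace, diag, mul_apply, conjTranspose_apply,
        mul_ite, ite_mul, mul_zero, zero_mul, Finset.sum_ite_eq', Finset.mem_univ, if_true,
        Finset.mul_sum]
      refine Finset.sum_congr rfl fun i _ => ?_
      rw [Finset.sum_comm]
      refine Finset.sum_congr rfl fun j _ => Finset.sum_congr rfl fun k _ => ?_
      ring
    · simp only [corrGram, localVec, fromBlocks_apply₂₂, of_apply, Sum.elim_inr,
        Fintype.sum_prod_type, ← trace_ptrA_mul, trace, diag, mul_apply, conjTranspose_apply,
        mul_ite, ite_mul, mul_zero, zero_mul, Finset.sum_ite_eq', Finset.mem_univ, if_true,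
        Finset.mul_sum]
      refine Finset.sum_congr rfl fun i _ => ?_
      rw [Finset.sum_comm]
      refine Finset.sum_congr rfl fun j _ => Finset.sum_congr rfl fun k _ => ?_
      ring
  · simp only [corrGram, localVec, fromBlocks_apply₂₁, of_apply, Sum.elim_inr, Sum.elim_inl,
      ← Fintype.sum_prod_type', expect_eq_sum, conjTranspose_apply]
    refine Fintype.sum_equiv ⟨fun p => (p.2.2, p.1.1, p.2.1, p.1.2),
      fun q => ((q.2.1, q.2.2.2), (q.2.2.1, q.1)), fun _ => rfl, fun _ => rfl⟩ _ _ fun p => ?_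
    simp only [Equiv.coe_fn_mk]
    ring
  · simp only [corrGram, localVec, fromBlocks_apply₁₂, of_apply, Sum.elim_inr, Sum.elim_inl,
      ← Fintype.sum_prod_type', expect_eq_sum, conjTranspose_apply, conjTranspose_conjTranspose]
    refine Fintype.sum_equiv ⟨fun p => (p.1.1, p.2.2, p.1.2, p.2.1),
      fun q => ((q.1, q.2.2.1), (q.2.2.2, q.2.1)), fun _ => rfl, fun _ => rfl⟩ _ _ fun p => ?_
    simp only [Equiv.coe_fn_mk]
    ring

lemma sum_star_mul_vecMulVec_mul {P Q : Type*} [Fintype P] [Fintype Q] (w x : P → ℂ)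
    (w' x' : Q → ℂ) :
    ∑ p, ∑ q, star (x p) * (star (w p) * w' q) * x' q
      = star (∑ p, w p * x p) * ∑ q, w' q * x' q := by
  rw [star_sum, Finset.sum_mul_sum]
  refine Finset.sum_congr rfl fun j _ => Finset.sum_congr rfl fun k _ => ?_
  rw [star_mul']
  ring

lemma corrMean_quadratic_form (c : ℝ) (X : Matrix A A ℂ) (Y : Matrix B B ℂ) :
    star (localVec X Y) ⬝ᵥ
        (blockWeight _ _ c ⊙ vecMulVec (star (corrMean ρ)) (corrMean ρ)) *ᵥ localVec X Y =
      c * (star (expect ρ X 1) * expect ρ X 1 + star (expect ρ 1 Y) * expect ρ 1 Y) +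
        (expect ρ X 1 * star (expect ρ 1 Y) + star (expect ρ X 1) * expect ρ 1 Y) := by
  rw [star_dotProduct_blockWeight_hadamard_mulVec]
  simp only [vecMulVec_apply, Pi.star_apply, sum_star_mul_vecMulVec_mul, corrMean_sum_inl,
    corrMean_sum_inr]
  ring

lemma posSemidef_corrGram (hρ : ρ.PosSemidef) : (corrGram ρ).PosSemidef := by
  refine .of_dotProduct_mulVec_nonneg (corrGram_isHermitian hρ.1) fun x => ?_
  obtain ⟨X, Y, rfl⟩ : ∃ X Y, x = localVec X Y :=
    ⟨of fun a a' => x (.inl (a, a')), of fun b b' => x (.inr (b, b')), by ext (_ | _) <;> rfl⟩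
  rw [← blockWeight_one_hadamard (corrGram ρ), corrGram_quadratic_form hρ.1]
  simpa using expect_local_sum_nonneg hρ X Y

lemma posSemidef_corrGram_sub_iff (hρ : IsDensity ρ) {c : ℝ} :
    (blockWeight _ _ c ⊙
      (corrGram ρ - vecMulVec (star (corrMean ρ)) (corrMean ρ))).PosSemidef ↔
      IsCorrBound ρ c := by
  have form (X : Matrix A A ℂ) (Y : Matrix B B ℂ) :=
    congrArg₂ (· - ·) (corrGram_quadratic_form hρ.1.1 c X Y)
      (corrMean_quadratic_form (ρ := ρ) c X Y)
  simp only [← dotProduct_sub, ← sub_mulVec] at form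
  have hsub (E M N : Matrix ((A × A) ⊕ (B × B)) ((A × A) ⊕ (B × B)) ℂ) :
      E ⊙ (M - N) = E ⊙ M - E ⊙ N := by
    ext
    simp [mul_sub]
  rw [hsub]
  constructor
  · intro h X Y hX hY
    have := (Complex.le_def.1 (h.dotProduct_mulVec_nonneg (localVec X Y))).1
    rw [form, hX, hY] at this
    simp only [Complex.add_re, Complex.re_ofReal_mul, RCLike.star_def,
      Complex.conj_re, Complex.zero_re, mul_zero, add_zero, sub_zero, map_zero] at this
    linarith
  · intro h
    refine .of_dotProduct_mulVec_nonneg ?_ fun x => ?_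
    · exact ((blockWeight_isHermitian _ _ c).hadamard (corrGram_isHermitian hρ.1.1)).sub
        ((blockWeight_isHermitian _ _ c).hadamard
          (posSemidef_vecMulVec_star_self (corrMean ρ)).1)
    obtain ⟨X, Y, rfl⟩ : ∃ X Y, x = localVec X Y :=
      ⟨of fun a a' => x (.inl (a, a')), of fun b b' => x (.inr (b, b')), by ext (_ | _) <;> rfl⟩
    rw [form]
    have h1 : expect ρ 1 1 = 1 := by rw [expect_one_one, hρ.2]
    have hXs : expect ρ Xᴴ 1 = star (expect ρ X 1) := by
      rw [← expect_conjTranspose hρ.1.1, conjTranspose_one]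
    have hYs : expect ρ 1 Yᴴ = star (expect ρ 1 Y) := by
      rw [← expect_conjTranspose hρ.1.1, conjTranspose_one]
    set m := expect ρ X 1 with hm
    set m' := expect ρ 1 Y with hm'
    have key := h (X - m • 1) (Y - m' • 1)
      (by rw [expect_sub_left, expect_smul_left, h1, hm, mul_one, sub_self])
      (by rw [expect_sub_right, expect_smul_right, h1, hm', mul_one, sub_self])
    have ha : expect ρ ((X - m • 1) * (X - m • 1)ᴴ) 1 = expect ρ (X * Xᴴ) 1 - star m * m := by
      simp only [conjTranspose_sub, conjTranspose_smul, conjTranspose_one, mul_sub, sub_mul,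
        expect_sub_left, expect_smul_left, smul_mul_assoc, mul_smul_comm, one_mul, mul_one, hXs,
        h1, ← hm]
      ring
    have hb : expect ρ 1 ((Y - m' • 1) * (Y - m' • 1)ᴴ)
        = expect ρ 1 (Y * Yᴴ) - star m' * m' := by
      simp only [conjTranspose_sub, conjTranspose_smul, conjTranspose_one, mul_sub, sub_mul,
        expect_sub_right, expect_smul_right, smul_mul_assoc, mul_smul_comm, one_mul, mul_one, hYs,
        h1, ← hm']
      ring
    have hab : expect ρ (X - m • 1) (Y - m' • 1)ᴴ = expect ρ X Yᴴ - m * star m' := by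
      simp only [conjTranspose_sub, conjTranspose_smul, conjTranspose_one, expect_sub_right,
        expect_smul_right, expect_sub_left, expect_smul_left, hYs, h1, ← hm]
      ring
    have hai := (Complex.le_def.1
      (expect_mul_conjTranspose_left_nonneg hρ.1 (X - m • (1 : Matrix A A ℂ)))).2
    have hbi := (Complex.le_def.1
      (expect_mul_conjTranspose_right_nonneg hρ.1 (Y - m' • (1 : Matrix B B ℂ)))).2
    have : (c : ℂ) * (expect ρ (X * Xᴴ) 1 + expect ρ 1 (Y * Yᴴ))
          + (expect ρ X Yᴴ + star (expect ρ X Yᴴ))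
          - (c * (star m * m + star m' * m') + (m * star m' + star m * m'))
        = c * (expect ρ ((X - m • 1) * (X - m • 1)ᴴ) 1
            + expect ρ 1 ((Y - m' • 1) * (Y - m' • 1)ᴴ))
          + (expect ρ (X - m • 1) (Y - m' • 1)ᴴ + star (expect ρ (X - m • 1) (Y - m' • 1)ᴴ)) := by
      rw [ha, hb, hab, star_sub, star_mul', star_star]
      ring
    rw [this, Complex.le_def]
    simp only [Complex.add_re, Complex.add_im, Complex.re_ofReal_mul, Complex.im_ofReal_mul,
      RCLike.star_def, Complex.conj_re, Complex.conj_im, ← hai, ← hbi, Complex.zero_re,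
      Complex.zero_im]
    exact ⟨by linarith, by ring⟩

end CorrGram

section TensorState

variable {A B : Type*} {n : ℕ}

/-- The tensor product of a finite family of bipartite states, with all A-systems grouped
together. -/
def tensorState (τ : Fin n → Matrix (A × B) (A × B) ℂ) :
    Matrix ((Fin n → A) × (Fin n → B)) ((Fin n → A) × (Fin n → B)) ℂ :=
  fun x y => ∏ i, τ i (x.1 i, x.2 i) (y.1 i, y.2 i)

/-- The `i`-th coordinate of the index of a local matrix unit of a tensor product. -/
def localCoord (i : Fin n) (p : ((Fin n → A) × (Fin n → A)) ⊕ ((Fin n → B) × (Fin n → B))) :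
    (A × A) ⊕ (B × B) :=
  Sum.map (fun q => (q.1 i, q.2 i)) (fun q => (q.1 i, q.2 i)) p

variable [Fintype A] [Fintype B] (τ : Fin n → Matrix (A × B) (A × B) ℂ)

omit [Fintype A] in
lemma ptrB_tensorState [DecidableEq B] (a a' : Fin n → A) :
    ptrB (tensorState τ) a a' = ∏ i, ptrB (τ i) (a i) (a' i) := by
  simp [ptrB, tensorState, Finset.prod_univ_sum]

omit [Fintype B] in
lemma ptrA_tensorState [DecidableEq A] (b b' : Fin n → B) :
    ptrA (tensorState τ) b b' = ∏ i, ptrA (τ i) (b i) (b' i) := by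
  simp [ptrA, tensorState, Finset.prod_univ_sum]

variable [DecidableEq A] [DecidableEq B]

lemma trace_ptrB {A B : Type*} [Fintype A] [Fintype B] (ρ : Matrix (A × B) (A × B) ℂ) :
    (ptrB ρ).trace = ρ.trace := by
  simp [ptrB, trace, Fintype.sum_prod_type]

omit [DecidableEq A] in
lemma trace_tensorState : (tensorState τ).trace = ∏ i, (τ i).trace := by
  simp_rw [← trace_ptrB, trace, diag, ptrB_tensorState, Finset.prod_univ_sum,
    Fintype.piFinset_univ]

lemma corrMean_tensorState (p) :
    corrMean (tensorState τ) p = ∏ i, corrMean (τ i) (localCoord i p) := by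
  rcases p with p | p <;>
    simp [corrMean, localCoord, ptrB_tensorState, ptrA_tensorState]

lemma corrGram_tensorState (p q) :
    corrGram (tensorState τ) p q = ∏ i, corrGram (τ i) (localCoord i p) (localCoord i q) := by
  rcases p with p | p <;> rcases q with q | q <;>
    simp [corrGram, localCoord, ptrB_tensorState, ptrA_tensorState, Finset.prod_ite_zero,
      funext_iff, tensorState]

variable {τ}

omit [DecidableEq A] in
lemma IsDensity.tensorState (hτ : ∀ i, IsDensity (τ i)) : IsDensity (tensorState τ) := by
  refine ⟨?_, by rw [trace_tensorState, Finset.prod_eq_one fun i _ => (hτ i).2]⟩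
  exact posSemidef_entrywise_prod
    (fun i => (hτ i).1.submatrix fun x : (Fin n → A) × (Fin n → B) => (x.1 i, x.2 i))
    Finset.univ

lemma IsCorrBound.tensorState (hτ : ∀ i, IsDensity (τ i)) {c : ℝ}
    (h : ∀ i, IsCorrBound (τ i) c) : IsCorrBound (tensorState τ) c := by
  rw [← posSemidef_corrGram_sub_iff (.tensorState hτ)]
  convert posSemidef_hadamard_entrywise_prod_sub
    (E := blockWeight ((Fin n → A) × (Fin n → A)) ((Fin n → B) × (Fin n → B)) c)
    (fun i => (posSemidef_corrGram (hτ i).1).submatrix (localCoord i))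
    (fun i => (posSemidef_vecMulVec_star_self (corrMean (τ i))).submatrix (localCoord i))
    (fun i => ?_) Finset.univ using 3
  · ext p q
    exact corrGram_tensorState τ p q
  · ext p q
    simp [vecMulVec_apply, corrMean_tensorState, Finset.prod_mul_distrib]
  · convert ((posSemidef_corrGram_sub_iff (hτ i)).2 (h i)).submatrix (localCoord i) using 1
    ext (p | p) (q | q) <;> simp [blockWeight, localCoord]

end TensorState

section Decomposition

variable {A B A' B' ι κ : Type*} [Fintype A] [Fintype B] [Fintype A'] [Fintype B']
  [Fintype ι] [Fintype κ]

lemma IsDensity.applyLocal [DecidableEq A] [DecidableEq B] [DecidableEq A'] [DecidableEq B']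
    {ρ : Matrix (A × B) (A × B) ℂ} (hρ : IsDensity ρ) {K : ι → Matrix A' A ℂ}
    {L : κ → Matrix B' B ℂ} (hK : ∑ k, (K k)ᴴ * K k = 1) (hL : ∑ m, (L m)ᴴ * L m = 1) :
    IsDensity (applyLocal K L ρ) := by
  constructor
  · exact posSemidef_sum _ fun k _ => posSemidef_sum _ fun m _ =>
      hρ.1.mul_mul_conjTranspose_same _
  · rw [← expect_one_one, expect_applyLocal, krausDual_one hK, krausDual_one hL, expect_one_one,
      hρ.2]

omit [Fintype A'] [Fintype B'] in
lemma applyLocal_sum_smul {α : Type*} [Fintype α] (K : ι → Matrix A' A ℂ)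
    (L : κ → Matrix B' B ℂ) (p : α → ℝ) (τ : α → Matrix (A × B) (A × B) ℂ) :
    applyLocal K L (∑ f, p f • τ f) = ∑ f, p f • applyLocal K L (τ f) := by
  simp only [applyLocal, Matrix.mul_sum, Matrix.sum_mul, Matrix.mul_smul, Matrix.smul_mul,
    Finset.smul_sum]
  simp_rw [Finset.sum_comm (s := (Finset.univ : Finset κ))]
  exact Finset.sum_comm

omit [Fintype A] [Fintype B] in
lemma powState_sum_smul {m : ℕ} (p : Fin m → ℝ) (τ : Fin m → Matrix (A × B) (A × B) ℂ) (n : ℕ) :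
    powState (∑ i, p i • τ i) n
      = ∑ f : Fin n → Fin m, (∏ i, p (f i)) • tensorState fun i => τ (f i) := by
  ext x y
  simp only [powState, Matrix.sum_apply, Matrix.smul_apply, tensorState, Finset.prod_univ_sum,
    Fintype.piFinset_univ, Complex.real_smul, Finset.prod_mul_distrib, Complex.ofReal_prod]

lemma muEnt_le_of_decomposition {α : Type*} [Fintype α] {σ : Matrix (A × B) (A × B) ℂ} {r : ℝ}
    (hr : 0 ≤ r) {p : α → ℝ} {τ : α → Matrix (A × B) (A × B) ℂ} (hp : ∀ i, 0 ≤ p i)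
    (hp1 : ∑ i, p i = 1) (hτ : ∀ i, IsDensity (τ i)) (hσ : σ = ∑ i, p i • τ i)
    (h : ∀ i, mu (τ i) ≤ r) : muEnt σ ≤ r := by
  let e := (Fintype.equivFin α).symm
  have hmem : muEnt σ ≤ ⨆ i, mu (τ (e i)) := by
    refine csInf_le ⟨0, ?_⟩ ⟨Fintype.card α, p ∘ e, τ ∘ e, fun i => hp _, ?_, fun i => hτ _, ?_,
      rfl⟩
    · rintro r ⟨m, p, τ, -, -, -, -, rfl⟩
      exact Real.iSup_nonneg fun i => mu_nonneg
    · rw [← hp1]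
      exact e.sum_comp p
    · rw [hσ]
      exact (e.sum_comp fun i => p i • τ i).symm
  exact hmem.trans (Real.iSup_le (fun i => h _) hr)

end Decomposition

/-- If `ρ^{⊗n}` can be locally transformed to `σ`, then `μ_ent(ρ) ≥ μ_ent(σ)`. -/
theorem muEnt_ge_of_local_transform_pow {dA dB dE dF : ℕ} {ι κ : Type*} [Fintype ι] [Fintype κ]
    (ρ : Matrix (Fin dA × Fin dB) (Fin dA × Fin dB) ℂ) (hρ : IsDensity ρ)
    (n : ℕ) (hn : 1 ≤ n)
    (K : ι → Matrix (Fin dE) (Fin n → Fin dA) ℂ)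
    (L : κ → Matrix (Fin dF) (Fin n → Fin dB) ℂ)
    (hK : ∑ k, (K k)ᴴ * K k = 1) (hL : ∑ m, (L m)ᴴ * L m = 1)
    (σ : Matrix (Fin dE × Fin dF) (Fin dE × Fin dF) ℂ)
    (hσ : σ = applyLocal K L (powState ρ n)) :
    muEnt ρ ≥ muEnt σ := by
  refine le_csInf ⟨_, 1, fun _ => 1, fun _ => ρ, by simp, by simp, fun _ => hρ, by simp, rfl⟩ ?_
  rintro r ⟨m, p, τ, hp, hp1, hτ, hdecomp, rfl⟩
  have hr : 0 ≤ ⨆ i, mu (τ i) := Real.iSup_nonneg fun i => mu_nonneg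
  have hmu (i : Fin m) : mu (τ i) ≤ ⨆ i, mu (τ i) :=
    le_ciSup (Set.finite_range fun i => mu (τ i)).bddAbove i
  have hden (f : Fin n → Fin m) : IsDensity (tensorState fun i => τ (f i)) :=
    .tensorState fun i => hτ (f i)
  have hcorr (f : Fin n → Fin m) :
      IsCorrBound (tensorState fun i => τ (f i)) (⨆ i, mu (τ i)) :=
    .tensorState (fun i => hτ (f i)) fun i => isCorrBound_of_mu_le (hτ (f i)).1 (hmu (f i))
  have hsum : ∑ f : Fin n → Fin m, ∏ i, p (f i) = 1 := by
    rw [← Fintype.piFinset_univ, ← Finset.prod_univ_sum (fun _ : Fin n => Finset.univ) fun _ => p]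
    simp [hp1]
  rw [hdecomp, powState_sum_smul, applyLocal_sum_smul] at hσ
  exact muEnt_le_of_decomposition hr (fun f => Finset.prod_nonneg fun i _ => hp (f i)) hsum
    (fun f => (hden f).applyLocal hK hL) hσ
    fun f => ((hcorr f).applyLocal (hden f).1 hr hK hL).mu_le hr
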